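/- Let b = 5·2^n with n ≥ 2. For every integer t with 3 ≤ t ≤ n + 2, K^t((1, 0)) = (b − 2^{t−2}, b − 2^{t−1}); in particular, K^{n+2}((1, 0)) = (4b/5, 3b/5). -/

import Mathlib

/-- The four base-`b` digits of `x` (viewed as a 4-digit string with leading
zeros allowed), sorted in decreasing order. -/
def sortedDigits (b x : ℕ) : List ℕ :=
  List.insertionSort (· ≥ ·) [x % b, x / b % b, x / b ^ 2 % b, x / b ^ 3 % b]

/-- The 4-digit base-`b` Kaprekar function `K_b(x) = D - A`. -/
def Kap (b x : ℕ) : ℕ :=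
  let l := sortedDigits b x
  (l[0]! * b ^ 3 + l[1]! * b ^ 2 + l[2]! * b + l[3]!) -
    (l[3]! * b ^ 3 + l[2]! * b ^ 2 + l[1]! * b + l[0]!)

/-- The difference pair `(a₃ - a₀, a₂ - a₁)` of a 4-digit base-`b` input. -/
def diffPair (b x : ℕ) : ℕ × ℕ :=
  let l := sortedDigits b x
  (l[0]! - l[3]!, l[1]! - l[2]!)

/-- `S_b`: the set of 4-digit base-`b` inputs whose sequence of Kaprekar
iterates is eventually constant and nonzero. -/
def KapSet (b : ℕ) : Set ℕ :=
  {x | x < b ^ 4 ∧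
    ∃ t, (∀ s, t ≤ s → (Kap b)^[s] x = (Kap b)^[t] x) ∧ (Kap b)^[t] x ≠ 0}

/-- Arrange the two coordinates of a pair in decreasing order. -/
def sort2 (p : ℕ × ℕ) : ℕ × ℕ := (max p.1 p.2, min p.1 p.2)

/-- A base-`b` difference pair: `b - 1 ≥ d ≥ d' ≥ 0`. -/
def IsDiffPair (b : ℕ) (p : ℕ × ℕ) : Prop := p.2 ≤ p.1 ∧ p.1 ≤ b - 1

/-- The Kaprekar map on base-`b` difference pairs. -/
def Kpair (b : ℕ) (p : ℕ × ℕ) : ℕ × ℕ :=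
  if p.1 = 0 ∧ p.2 = 0 then (0, 0)
  else if p.2 = 0 then
    -- type (c)
    sort2 (p.1 - 1, b - p.1)
  else if p.1 = p.2 ∨ p.1 + p.2 = b then
    -- type (b)
    sort2 ((2 * (p.1 : ℤ) - ((b : ℤ) - 1)).natAbs,
           (2 * (p.1 : ℤ) - ((b : ℤ) + 1)).natAbs)
  else
    -- type (a)
    sort2 ((2 * (p.1 : ℤ) - (b : ℤ)).natAbs, (2 * (p.2 : ℤ) - (b : ℤ)).natAbs)

theorem sort2_of_ge {p q : ℕ} (h : q ≤ p) : sort2 (p, q) = (p, q) := by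
  simp [sort2, h]

theorem sort2_of_le {p q : ℕ} (h : p ≤ q) : sort2 (p, q) = (q, p) := by
  simp [sort2, h]

theorem Kpair_iterate_three_one_zero {b : ℕ} (hb : 5 ≤ b) :
    (Kpair b)^[3] (1, 0) = (b - 2, b - 4) := by
  have h₁ : Kpair b (1, 0) = (b - 1, 0) := by
    simp [Kpair, sort2]
  have h₂ : Kpair b (b - 1, 0) = (b - 2, 1) := by
    have hne : b - 1 ≠ 0 := by omega
    have he : b - (b - 1) = 1 := by omega
    simp only [Kpair, hne, false_and, if_false, if_true, he]
    exact sort2_of_ge (by omega)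
  have h₃ : Kpair b (b - 2, 1) = (b - 2, b - 4) := by
    rw [Kpair, if_neg (by simp), if_neg (by simp), if_neg (by simp only; omega),
      sort2_of_le (by simp only; omega)]
    ext <;> simp only <;> omega
  simp only [Function.iterate_succ, Function.iterate_zero, Function.comp_apply, id, h₁, h₂, h₃]

theorem Kpair_sub_sub_two_mul {b x : ℕ} (hx : 0 < x) (hxb : 4 * x < b) :
    Kpair b (b - x, b - 2 * x) = (b - 2 * x, b - 4 * x) := by
  rw [Kpair, if_neg (by simp only; omega), if_neg (by simp only; omega),
    if_neg (by simp only; omega), sort2_of_ge (by simp only; omega)]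
  ext <;> simp only <;> omega

/-- the trajectory of `(1, 0)` for `b = 5·2^n`, `n ≥ 2`. -/
theorem kaprekar_trajectory_one_zero (n b : ℕ) (hn : 2 ≤ n)
    (hb : b = 5 * 2 ^ n) :
    (∀ t : ℕ, 3 ≤ t → t ≤ n + 2 →
      (Kpair b)^[t] (1, 0) = (b - 2 ^ (t - 2), b - 2 ^ (t - 1))) ∧
    (Kpair b)^[n + 2] (1, 0) = (4 * b / 5, 3 * b / 5) := by
  have trajectory : ∀ t : ℕ, 3 ≤ t → t ≤ n + 2 →
      (Kpair b)^[t] (1, 0) = (b - 2 ^ (t - 2), b - 2 ^ (t - 1)) := by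
    intro t ht
    induction t, ht using Nat.le_induction with
    | base =>
      intro _
      have hpos : 0 < 2 ^ n := by positivity
      exact Kpair_iterate_three_one_zero (by omega)
    | succ t ht ih =>
      intro htn
      obtain ⟨k, rfl⟩ := Nat.exists_eq_add_of_le' (by omega : 2 ≤ t)
      have hpos : 0 < 2 ^ k := by positivity
      have hle : 2 ^ (k + 1) ≤ 2 ^ n := Nat.pow_le_pow_right (by norm_num) (by omega)
      rw [Function.iterate_succ_apply', ih (by omega)]
      simp only [Nat.add_sub_cancel, show k + 2 - 1 = k + 1 by omega,
        show k + 2 + 1 - 2 = k + 1 by omega, pow_succ'] at hle ⊢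
      rw [Kpair_sub_sub_two_mul hpos (by omega), ← mul_assoc, show 2 * 2 = 4 from rfl]
  refine ⟨trajectory, ?_⟩
  rw [trajectory (n + 2) (by omega) le_rfl, Nat.add_sub_cancel,
    show n + 2 - 1 = n + 1 by omega, pow_succ']
  ext <;> simp only <;> omega
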